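/- Let Ω ⊆ ℝ^N be a bounded open set. For each n let (y_n, D_n, f_n), and let (y, D, f), be a.e. approximately differentiable triples on Ω such that x ↦ cof(f_n x), x ↦ det(f_n x), x ↦ cof(f x) and x ↦ det(f x) are all integrable on Ω. If y_n → y almost everywhere in Ω, cof(f_n ·) converges weakly in L¹(Ω; ℝ^{N×N}) to cof(f ·) (entrywise, tested against bounded measurable functions), and det(f_n ·) converges weakly in L¹(Ω) to det(f ·), then the surface energy is lower semicontinuous: 𝒮(y) ≤ liminf_{n→∞} 𝒮(y_n). -/

import Mathlib

open MeasureTheory Filter Topology Set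
open scoped ENNReal NNReal

noncomputable section

abbrev Euc (N : ℕ) := EuclideanSpace ℝ (Fin N)

/-- An a.e. approximately differentiable map on `A`, encoded as a triple `(u, D, f)`. -/
def ApproxDiffTriple {N : ℕ} (A D : Set (Euc N)) (u : Euc N → Euc N)
    (f : Euc N → Euc N →L[ℝ] Euc N) : Prop :=
  MeasurableSet D ∧ D ⊆ A ∧ volume (A \ D) = 0 ∧ ∀ x ∈ D, HasFDerivWithinAt u (f x) D x

/-- An admissible deformation on `Ω` (the class `𝒴(Ω)` of the paper). -/
def AdmissibleDef {N : ℕ} (Ω D : Set (Euc N)) (y : Euc N → Euc N)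
    (f : Euc N → Euc N →L[ℝ] Euc N) : Prop :=
  ApproxDiffTriple Ω D y f ∧ Set.InjOn y D ∧ (∀ x ∈ D, 0 < (f x).det) ∧
    IntegrableOn (fun x => (f x).det) Ω volume

/-- Weak convergence in `L¹(Ω)`, tested against bounded measurable functions. -/
def WeakL1ConvOn {N : ℕ} (Ω : Set (Euc N)) (u : ℕ → Euc N → ℝ) (v : Euc N → ℝ) : Prop :=
  ∀ g : Euc N → ℝ, Measurable g → (∃ C : ℝ, ∀ x, |g x| ≤ C) →
    Tendsto (fun n => ∫ x in Ω, u n x * g x) atTop (𝓝 (∫ x in Ω, v x * g x))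

/-- The matrix of a continuous linear endomorphism of `ℝ^N` in the standard basis. -/
def clmMatrix {N : ℕ} (T : Euc N →L[ℝ] Euc N) : Matrix (Fin N) (Fin N) ℝ :=
  LinearMap.toMatrix (EuclideanSpace.basisFun (Fin N) ℝ).toBasis
    (EuclideanSpace.basisFun (Fin N) ℝ).toBasis T.toLinearMap

/-- The cofactor matrix `cof M = (adjugate M)ᵀ` of a continuous linear endomorphism. -/
def cofCLM {N : ℕ} (T : Euc N →L[ℝ] Euc N) : Matrix (Fin N) (Fin N) ℝ :=
  (clmMatrix T).adjugate.transpose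

/-- Frobenius inner product of matrices. -/
def frobInner {N : ℕ} (A B : Matrix (Fin N) (Fin N) ℝ) : ℝ :=
  ∑ i, ∑ j, A i j * B i j

/-- Matrix of partial derivatives of `η` in the first (Lagrangian) variable. -/
def DxMatrix {N : ℕ} (η : Euc N × Euc N → Euc N) (x ξ : Euc N) :
    Matrix (Fin N) (Fin N) ℝ :=
  clmMatrix (fderiv ℝ (fun x' => η (x', ξ)) x)

/-- Divergence of `η` in the second (Eulerian) variable. -/
def divXi {N : ℕ} (η : Euc N × Euc N → Euc N) (x ξ : Euc N) : ℝ :=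
  LinearMap.trace ℝ (Euc N) (fderiv ℝ (fun ξ' => η (x, ξ')) ξ).toLinearMap

/-- The functional `𝒮_y(η)` of the paper. -/
def SEta {N : ℕ} (Ω : Set (Euc N)) (y : Euc N → Euc N)
    (f : Euc N → Euc N →L[ℝ] Euc N) (η : Euc N × Euc N → Euc N) : ℝ :=
  ∫ x in Ω, (frobInner (cofCLM (f x)) (DxMatrix η x (y x)) + divXi η x (y x) * (f x).det)

/-- Admissible test functions: smooth, compactly supported in `Ω × ℝ^N`,
with sup-norm at most `1`. -/
def TestFun {N : ℕ} (Ω : Set (Euc N)) (η : Euc N × Euc N → Euc N) : Prop :=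
  ContDiff ℝ (⊤ : ℕ∞) η ∧ HasCompactSupport η ∧
    tsupport η ⊆ Ω ×ˢ (Set.univ : Set (Euc N)) ∧ ∀ p, ‖η p‖ ≤ 1

/-- The surface energy `𝒮(y) = sup { 𝒮_y(η) : η admissible }`, valued in `[0, +∞]`. -/
def surfaceEnergy {N : ℕ} (Ω : Set (Euc N)) (y : Euc N → Euc N)
    (f : Euc N → Euc N →L[ℝ] Euc N) : ℝ≥0∞ :=
  ⨆ η : { η : Euc N × Euc N → Euc N // TestFun Ω η }, ENNReal.ofReal (SEta Ω y f η.1)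

/-- A sequence of integrable functions whose integrals against bounded measurable functions tend
to zero can be tested against almost everywhere bounded functions. -/
theorem tendsto_integral_mul_of_ae_bound {α : Type*} [MeasurableSpace α] {μ : Measure α}
    {v : ℕ → α → ℝ}
    (hv : ∀ g : α → ℝ, Measurable g → (∃ C : ℝ, ∀ x, |g x| ≤ C) →
      Tendsto (fun n => ∫ x, v n x * g x ∂μ) atTop (𝓝 0))
    {g : α → ℝ} (hg : AEStronglyMeasurable g μ) (hg1 : ∀ᵐ x ∂μ, |g x| ≤ 1) :
    Tendsto (fun n => ∫ x, v n x * g x ∂μ) atTop (𝓝 0) := by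
  have hm : Measurable (hg.mk g) := hg.stronglyMeasurable_mk.measurable
  have key := hv (fun x => max (-1) (min 1 (hg.mk g x)))
    (measurable_const.max (measurable_const.min hm))
    ⟨1, fun x => abs_le.2 ⟨le_max_left _ _, max_le (by norm_num) (min_le_left _ _)⟩⟩
  refine key.congr fun n => integral_congr_ae ?_
  filter_upwards [hg.ae_eq_mk, hg1] with x hx h1
  rw [← hx, min_eq_right (abs_le.1 h1).2, max_eq_right (abs_le.1 h1).1]

/-- Uniform smallness for weakly null sequences in `L¹`: the functionals `h ↦ ∫ v n * h` are
eventually uniformly small on functions bounded by `1` with small `L¹` norm. -/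
theorem exists_forall_abs_integral_mul_le {α : Type*} [MeasurableSpace α] {μ : Measure α}
    [IsFiniteMeasure μ] {v : ℕ → α → ℝ} (hvi : ∀ n, Integrable (v n) μ)
    (hv : ∀ g : α → ℝ, Measurable g → (∃ C : ℝ, ∀ x, |g x| ≤ C) →
      Tendsto (fun n => ∫ x, v n x * g x ∂μ) atTop (𝓝 0))
    {ε : ℝ} (hε : 0 < ε) :
    ∃ r > 0, ∃ k : ℕ, ∀ h : α → ℝ, AEStronglyMeasurable h μ → (∀ x, |h x| ≤ 1) →
      ∫ x, |h x| ∂μ < r → ∀ n ≥ k, |∫ x, v n x * h x ∂μ| ≤ ε := by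
  have hmul : ∀ n {g : α → ℝ}, AEStronglyMeasurable g μ → (∀ᵐ x ∂μ, |g x| ≤ 1) →
      Integrable (fun x => v n x * g x) μ := fun n g hg hg1 =>
    (hvi n).mul_bdd (c := 1) hg (by simpa using hg1)
  have hint : ∀ {g : α → ℝ}, AEStronglyMeasurable g μ → (∀ᵐ x ∂μ, |g x| ≤ 1) →
      Integrable g μ := fun hg hg1 => Integrable.of_bound hg 1 (by simpa using hg1)
  have hsub : ∀ (s : ℕ → Lp ℝ 1 μ) (g : Lp ℝ 1 μ), Tendsto s atTop (𝓝 g) →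
      ∃ ns : ℕ → ℕ, StrictMono ns ∧
        ∀ᵐ x ∂μ, Tendsto (fun i => s (ns i) x) atTop (𝓝 (g x)) := fun s g hs =>
    (tendstoInMeasure_of_tendsto_Lp hs).exists_seq_tendsto_ae
  let K : Set (Lp ℝ 1 μ) := {g | ∀ᵐ x ∂μ, |g x| ≤ 1}
  have hK : IsClosed K := by
    refine IsSeqClosed.isClosed fun s g hs hsg => ?_
    obtain ⟨ns, -, hns⟩ := hsub s g hsg
    have hall : ∀ᵐ x ∂μ, ∀ i, |s i x| ≤ 1 := ae_all_iff.2 hs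
    change ∀ᵐ x ∂μ, |g x| ≤ 1
    filter_upwards [hns, hall] with x hx hb
    exact le_of_tendsto' hx.abs fun i => hb _
  let F : ℕ → Set K := fun k => {g | ∀ n ≥ k, |∫ x, v n x * g.1 x ∂μ| ≤ ε / 2}
  have hF : ∀ k, IsClosed (F k) := by
    intro k
    refine IsSeqClosed.isClosed fun s g hs hsg n hn => ?_
    obtain ⟨ns, -, hns⟩ := hsub (fun i => (s i).1) g.1
      ((continuous_subtype_val.tendsto g).comp hsg)
    have hlim : Tendsto (fun i => ∫ x, v n x * (s (ns i)).1 x ∂μ) atTop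
        (𝓝 (∫ x, v n x * g.1 x ∂μ)) := by
      refine tendsto_integral_of_dominated_convergence (fun x => |v n x|)
        (fun i => (hmul n (Lp.aestronglyMeasurable _) (s (ns i)).2).aestronglyMeasurable)
        (hvi n).abs (fun i => ?_) ?_
      · filter_upwards [(s (ns i)).2] with x hx
        rw [Real.norm_eq_abs, abs_mul]
        exact mul_le_of_le_one_right (abs_nonneg _) hx
      · filter_upwards [hns] with x hx
        exact hx.const_mul _
    exact le_of_tendsto' hlim.abs fun i => hs _ n hn
  have hU : ⋃ k, F k = univ := by
    refine eq_univ_of_forall fun g => mem_iUnion.2 ?_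
    have ht := tendsto_integral_mul_of_ae_bound hv (Lp.aestronglyMeasurable g.1) g.2
    obtain ⟨k, hk⟩ := (Metric.tendsto_atTop.1 ht) (ε / 2) (half_pos hε)
    refine ⟨k, fun n hn => ?_⟩
    have := hk n hn
    rw [Real.dist_0_eq_abs] at this
    exact this.le
  have : CompleteSpace K := hK.completeSpace_coe
  have : Nonempty K := ⟨⟨0, by
    change ∀ᵐ x ∂μ, |(0 : Lp ℝ 1 μ) x| ≤ 1
    filter_upwards [Lp.coeFn_zero ℝ 1 μ] with x hx
    rw [hx]
    simp⟩⟩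
  obtain ⟨k, g₀, hg₀⟩ := nonempty_interior_of_iUnion_of_closed hF hU
  obtain ⟨r, hr, hball⟩ := Metric.isOpen_iff.1 isOpen_interior g₀ hg₀
  have hb₀ : ∀ᵐ x ∂μ, |g₀.1 x| ≤ 1 := g₀.2
  have hm₀ : AEStronglyMeasurable g₀.1 μ := Lp.aestronglyMeasurable _
  have hnear : ∀ g : α → ℝ, AEStronglyMeasurable g μ → (∀ᵐ x ∂μ, |g x| ≤ 1) →
      ∫ x, |g x - g₀.1 x| ∂μ < r → ∀ n ≥ k, |∫ x, v n x * g x ∂μ| ≤ ε / 2 := by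
    intro g hg hg1 hd n hn
    have hgi := hint hg hg1
    have hcoe := hgi.coeFn_toL1
    have hgK : hgi.toL1 g ∈ K := by
      change ∀ᵐ x ∂μ, |hgi.toL1 g x| ≤ 1
      filter_upwards [hcoe, hg1] with x hx h1
      rwa [hx]
    have hdist : dist (⟨hgi.toL1 g, hgK⟩ : K) g₀ < r := by
      rw [Subtype.dist_eq, L1.dist_eq_integral_dist]
      refine lt_of_eq_of_lt (integral_congr_ae ?_) hd
      filter_upwards [hcoe] with x hx
      simp only [hx, Real.dist_eq]
    have hmem := interior_subset (hball hdist) n hn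
    have heq : ∫ x, v n x * hgi.toL1 g x ∂μ = ∫ x, v n x * g x ∂μ :=
      integral_congr_ae (by filter_upwards [hcoe] with x hx; rw [hx])
    rwa [← heq]
  refine ⟨r / 2, half_pos hr, k, fun h hh hh1 hhr n hn => ?_⟩
  have hhi : Integrable (fun x => |h x|) μ := (hint hh (ae_of_all _ hh1)).abs
  have hm₁ : AEStronglyMeasurable (fun x => (1 - |h x|) * g₀.1 x) μ :=
    (aestronglyMeasurable_const.sub hhi.aestronglyMeasurable).mul hm₀
  have hbd : ∀ᵐ x ∂μ, |(1 - |h x|) * g₀.1 x| ≤ 1 - |h x| := by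
    filter_upwards [hb₀] with x hx
    have h0 : 0 ≤ 1 - |h x| := sub_nonneg.2 (hh1 x)
    rw [abs_mul, abs_of_nonneg h0]
    exact mul_le_of_le_one_right h0 hx
  have hb₁ : ∀ᵐ x ∂μ, |(1 - |h x|) * g₀.1 x| ≤ 1 := by
    filter_upwards [hbd] with x hx
    linarith [abs_nonneg (h x)]
  have hm₂ : AEStronglyMeasurable (fun x => (1 - |h x|) * g₀.1 x + h x) μ := hm₁.add hh
  have hb₂ : ∀ᵐ x ∂μ, |(1 - |h x|) * g₀.1 x + h x| ≤ 1 := by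
    filter_upwards [hbd] with x hx
    linarith [abs_add_le ((1 - |h x|) * g₀.1 x) (h x)]
  have hclose : ∀ᵐ x ∂μ, |(1 - |h x|) * g₀.1 x - g₀.1 x| ≤ |h x| := by
    filter_upwards [hb₀] with x hx
    rw [show (1 - |h x|) * g₀.1 x - g₀.1 x = -(|h x| * g₀.1 x) by ring, abs_neg, abs_mul, abs_abs]
    exact mul_le_of_le_one_right (abs_nonneg _) hx
  have h₁ := hnear _ hm₁ hb₁ (by
    refine lt_of_le_of_lt (integral_mono_ae (((hint hm₁ hb₁).sub (hint hm₀ hb₀)).abs) hhi hclose) ?_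
    linarith) n hn
  have h₂ := hnear _ hm₂ hb₂ (by
    refine lt_of_le_of_lt (integral_mono_ae (((hint hm₂ hb₂).sub (hint hm₀ hb₀)).abs)
      (hhi.const_mul 2) ?_) ?_
    · filter_upwards [hclose] with x hx
      rw [show (1 - |h x|) * g₀.1 x + h x - g₀.1 x
        = ((1 - |h x|) * g₀.1 x - g₀.1 x) + h x by ring]
      linarith [abs_add_le ((1 - |h x|) * g₀.1 x - g₀.1 x) (h x)]
    · rw [integral_const_mul]
      linarith) n hn
  have heq : ∫ x, v n x * h x ∂μ
      = (∫ x, v n x * ((1 - |h x|) * g₀.1 x + h x) ∂μ)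
        - ∫ x, v n x * ((1 - |h x|) * g₀.1 x) ∂μ := by
    rw [← integral_sub (hmul n hm₂ hb₂) (hmul n hm₁ hb₁)]
    exact integral_congr_ae (ae_of_all _ fun x => by ring)
  rw [heq]
  refine (abs_sub _ _).trans ?_
  linarith

/-- The product of a weakly convergent sequence in `L¹` and a bounded sequence converging almost
everywhere converges in the sense of integrals. -/
theorem WeakL1ConvOn.tendsto_integral_mul {N : ℕ} {Ω : Set (Euc N)} (hΩ : volume Ω ≠ ∞)
    {u : ℕ → Euc N → ℝ} {w : Euc N → ℝ} (h : WeakL1ConvOn Ω u w)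
    (hu : ∀ n, IntegrableOn (u n) Ω) (hw : IntegrableOn w Ω)
    {g : ℕ → Euc N → ℝ} {g₀ : Euc N → ℝ} {C : ℝ}
    (hg : ∀ n, AEStronglyMeasurable (g n) (volume.restrict Ω))
    (hg₀ : AEStronglyMeasurable g₀ (volume.restrict Ω))
    (hgC : ∀ n x, |g n x| ≤ C) (hg₀C : ∀ x, |g₀ x| ≤ C)
    (hlim : ∀ᵐ x ∂volume.restrict Ω, Tendsto (fun n => g n x) atTop (𝓝 (g₀ x))) :
    Tendsto (fun n => ∫ x in Ω, u n x * g n x) atTop (𝓝 (∫ x in Ω, w x * g₀ x)) := by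
  have : IsFiniteMeasure (volume.restrict Ω) := isFiniteMeasure_restrict.2 hΩ
  have hC : 0 ≤ C := (abs_nonneg _).trans (hg₀C 0)
  have hbdd : ∀ {a b : Euc N → ℝ} {c : ℝ}, IntegrableOn a Ω →
      AEStronglyMeasurable b (volume.restrict Ω) → (∀ x, |b x| ≤ c) →
      Integrable (fun x => a x * b x) (volume.restrict Ω) := fun ha hb hc =>
    ha.mul_bdd hb (ae_of_all _ hc)
  have hvi : ∀ n, Integrable (fun x => u n x - w x) (volume.restrict Ω) :=
    fun n => (hu n).sub hw
  have hv : ∀ b : Euc N → ℝ, Measurable b → (∃ c : ℝ, ∀ x, |b x| ≤ c) →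
      Tendsto (fun n => ∫ x in Ω, (u n x - w x) * b x) atTop (𝓝 0) := by
    rintro b hb ⟨c, hc⟩
    have := (h b hb ⟨c, hc⟩).sub_const (∫ x in Ω, w x * b x)
    rw [sub_self] at this
    refine this.congr fun n => ?_
    rw [← integral_sub (hbdd (hu n) hb.aestronglyMeasurable hc)
      (hbdd hw hb.aestronglyMeasurable hc)]
    exact integral_congr_ae (ae_of_all _ fun x => by ring)
  -- The strong part: `∫ w * g n → ∫ w * g₀`.
  have hw_lim : Tendsto (fun n => ∫ x in Ω, w x * g n x) atTop (𝓝 (∫ x in Ω, w x * g₀ x)) := by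
    refine tendsto_integral_of_dominated_convergence (fun x => |w x| * C)
      (fun n => (hbdd hw (hg n) (hgC n)).aestronglyMeasurable) (hw.abs.mul_const C)
      (fun n => ae_of_all _ fun x => ?_) ?_
    · rw [Real.norm_eq_abs, abs_mul]
      exact mul_le_mul_of_nonneg_left (hgC n x) (abs_nonneg _)
    · filter_upwards [hlim] with x hx
      exact hx.const_mul _
  have hv₀ : Tendsto (fun n => ∫ x in Ω, (u n x - w x) * (g₀ x / (C + 1))) atTop (𝓝 0) :=
    tendsto_integral_mul_of_ae_bound hv (hg₀.mul_const (C + 1)⁻¹)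
      (ae_of_all _ fun x => by
        rw [abs_div, abs_of_pos (by linarith : 0 < C + 1),
          div_le_one (by linarith)]
        linarith [hg₀C x])
  have hc : 0 < 2 * (C + 1) := by linarith
  -- The oscillating part, normalised to be bounded by one.
  have hosc : Tendsto (fun n => ∫ x in Ω, (u n x - w x) * ((g n x - g₀ x) / (2 * (C + 1))))
      atTop (𝓝 0) := by
    have hm : ∀ n, AEStronglyMeasurable (fun x => (g n x - g₀ x) / (2 * (C + 1)))
        (volume.restrict Ω) := fun n => by
      simp only [div_eq_mul_inv]
      exact ((hg n).sub hg₀).mul_const _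
    have hb : ∀ n x, |(g n x - g₀ x) / (2 * (C + 1))| ≤ 1 := fun n x => by
      rw [abs_div, abs_of_pos hc, div_le_one hc]
      linarith [abs_sub (g n x) (g₀ x), hgC n x, hg₀C x]
    have hL1 : Tendsto (fun n => ∫ x in Ω, |(g n x - g₀ x) / (2 * (C + 1))|) atTop (𝓝 0) := by
      have := tendsto_integral_of_dominated_convergence (μ := volume.restrict Ω)
        (F := fun n x => |(g n x - g₀ x) / (2 * (C + 1))|) (f := fun _ => (0 : ℝ)) (fun _ => (1 : ℝ))
        (fun n => (hm n).norm) (integrable_const _)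
        (fun n => ae_of_all _ fun x => by simpa only [Real.norm_eq_abs, abs_abs] using hb n x) (by
          filter_upwards [hlim] with x hx
          simpa using ((hx.sub_const (g₀ x)).div_const (2 * (C + 1))).abs)
      simpa only [integral_zero] using this
    refine Metric.tendsto_atTop.2 fun ε hε => ?_
    obtain ⟨r, hr, k, hk⟩ := exists_forall_abs_integral_mul_le hvi hv (half_pos hε)
    obtain ⟨m, hm'⟩ := eventually_atTop.1 (hL1.eventually_lt_const hr)
    refine ⟨max k m, fun n hn => ?_⟩
    rw [Real.dist_0_eq_abs]
    have := hk _ (hm n) (hb n) (hm' n (le_of_max_le_right hn)) n (le_of_max_le_left hn)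
    linarith
  have hsum := (hw_lim.add (hv₀.const_mul (C + 1))).add (hosc.const_mul (2 * (C + 1)))
  simp only [mul_zero, add_zero] at hsum
  refine hsum.congr fun n => ?_
  rw [← integral_const_mul, ← integral_const_mul]
  have hC1 : C + 1 ≠ 0 := by linarith
  have e₁ : ∀ x, (C + 1) * ((u n x - w x) * (g₀ x / (C + 1))) = (u n x - w x) * g₀ x := fun x => by
    field_simp
  have e₂ : ∀ x, 2 * (C + 1) * ((u n x - w x) * ((g n x - g₀ x) / (2 * (C + 1))))
      = (u n x - w x) * (g n x - g₀ x) := fun x => by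
    field_simp
  simp only [e₁, e₂]
  have i₁ := hbdd hw (hg n) (hgC n)
  have i₂ := hbdd (hvi n) hg₀ hg₀C
  have i₃ : Integrable (fun x => (u n x - w x) * (g n x - g₀ x)) (volume.restrict Ω) :=
    hbdd (hvi n) ((hg n).sub hg₀) (c := C + C) fun x =>
      (abs_sub _ _).trans (add_le_add (hgC n x) (hg₀C x))
  have i₁₂ : Integrable (fun x => w x * g n x + (u n x - w x) * g₀ x) (volume.restrict Ω) :=
    i₁.add i₂
  rw [← integral_add i₁ i₂, ← integral_add i₁₂ i₃]
  exact integral_congr_ae (ae_of_all _ fun x => by ring)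

theorem ApproxDiffTriple.aemeasurable {N : ℕ} {A D : Set (Euc N)} {u : Euc N → Euc N}
    {f : Euc N → Euc N →L[ℝ] Euc N} (h : ApproxDiffTriple A D u f) :
    AEMeasurable u (volume.restrict A) := by
  obtain ⟨hD, hDA, h0, hd⟩ := h
  have hae : D =ᵐ[volume] A := hDA.eventuallyLE.antisymm (ae_le_set.2 h0)
  rw [← Measure.restrict_congr_set hae]
  exact ContinuousOn.aemeasurable (fun x hx => (hd x hx).continuousWithinAt) hD

theorem clmMatrix_apply {N : ℕ} (T : Euc N →L[ℝ] Euc N) (i j : Fin N) :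
    clmMatrix T i j = T (EuclideanSpace.single j 1) i := by
  simp [clmMatrix, LinearMap.toMatrix_apply]

theorem DxMatrix_apply {N : ℕ} {η : Euc N × Euc N → Euc N} (hη : Differentiable ℝ η)
    (x ξ : Euc N) (i j : Fin N) :
    DxMatrix η x ξ i j = fderiv ℝ η (x, ξ) (EuclideanSpace.single j 1, 0) i := by
  have h : HasFDerivAt (fun x' => η (x', ξ)) _ x :=
    (hη (x, ξ)).hasFDerivAt.comp x (hasFDerivAt_prodMk_left x ξ)
  rw [DxMatrix, clmMatrix_apply, h.fderiv]
  rfl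

theorem divXi_eq_sum {N : ℕ} {η : Euc N × Euc N → Euc N} (hη : Differentiable ℝ η)
    (x ξ : Euc N) :
    divXi η x ξ = ∑ i, fderiv ℝ η (x, ξ) (0, EuclideanSpace.single i 1) i := by
  have h : HasFDerivAt (fun ξ' => η (x, ξ')) _ ξ :=
    (hη (x, ξ)).hasFDerivAt.comp ξ (hasFDerivAt_prodMk_right x ξ)
  rw [divXi, h.fderiv, LinearMap.trace_eq_matrix_trace ℝ (EuclideanSpace.basisFun (Fin N) ℝ).toBasis]
  refine Finset.sum_congr rfl fun i _ => ?_
  simp [LinearMap.toMatrix_apply]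

/-- The product of a weakly convergent sequence in `L¹` with a bounded continuous function of the
point and of an almost everywhere convergent sequence of maps. -/
theorem WeakL1ConvOn.tendsto_integral_mul_comp {N : ℕ} {Ω : Set (Euc N)} (hΩ : volume Ω ≠ ∞)
    {u : ℕ → Euc N → ℝ} {w : Euc N → ℝ} (h : WeakL1ConvOn Ω u w)
    (hu : ∀ n, IntegrableOn (u n) Ω) (hw : IntegrableOn w Ω)
    {y : ℕ → Euc N → Euc N} {y₀ : Euc N → Euc N}
    (hy : ∀ n, AEMeasurable (y n) (volume.restrict Ω)) (hy₀ : AEMeasurable y₀ (volume.restrict Ω))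
    (hae : ∀ᵐ x ∂volume.restrict Ω, Tendsto (fun n => y n x) atTop (𝓝 (y₀ x)))
    {G : Euc N × Euc N → ℝ} (hG : Continuous G) {C : ℝ} (hC : ∀ p, |G p| ≤ C) :
    Tendsto (fun n => ∫ x in Ω, u n x * G (x, y n x)) atTop (𝓝 (∫ x in Ω, w x * G (x, y₀ x))) := by
  refine h.tendsto_integral_mul hΩ hu hw
    (fun n => (hG.measurable.comp_aemeasurable (aemeasurable_id.prodMk (hy n))).aestronglyMeasurable)
    (hG.measurable.comp_aemeasurable (aemeasurable_id.prodMk hy₀)).aestronglyMeasurable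
    (fun n x => hC _) (fun x => hC _) ?_
  filter_upwards [hae] with x hx
  exact (hG.tendsto _).comp (tendsto_const_nhds.prodMk_nhds hx)

/-- Evaluation of the derivative of a compactly supported smooth map gives bounded continuous
functions. -/
theorem TestFun.continuous_and_bounded_fderiv {N : ℕ} {Ω : Set (Euc N)}
    {η : Euc N × Euc N → Euc N} (hη : TestFun Ω η) (v : Euc N × Euc N) (i : Fin N) :
    Continuous (fun p => fderiv ℝ η p v i) ∧ ∃ C : ℝ, ∀ p, |fderiv ℝ η p v i| ≤ C := by
  have hc : Continuous (fun p => fderiv ℝ η p v i) :=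
    (EuclideanSpace.proj (𝕜 := ℝ) i).continuous.comp
      ((hη.1.continuous_fderiv (by simp)).clm_apply continuous_const)
  have hs : HasCompactSupport (fun p => fderiv ℝ η p v i) :=
    (hη.2.1.fderiv (𝕜 := ℝ)).comp_left (g := fun T : Euc N × Euc N →L[ℝ] Euc N => T v i) (by simp)
  exact ⟨hc, hs.exists_bound_of_continuous hc⟩

theorem SEta_eq_sum {N : ℕ} {Ω : Set (Euc N)} {y : Euc N → Euc N}
    {f : Euc N → Euc N →L[ℝ] Euc N} (hy : AEMeasurable y (volume.restrict Ω))
    (hdet : IntegrableOn (fun x => (f x).det) Ω)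
    (hcof : ∀ i j, IntegrableOn (fun x => cofCLM (f x) i j) Ω)
    {η : Euc N × Euc N → Euc N} (hη : TestFun Ω η) :
    SEta Ω y f η =
      (∑ i, ∑ j, ∫ x in Ω, cofCLM (f x) i j
        * fderiv ℝ η (x, y x) (EuclideanSpace.single j 1, 0) i)
      + ∑ i, ∫ x in Ω, (f x).det * fderiv ℝ η (x, y x) (0, EuclideanSpace.single i 1) i := by
  have hd : Differentiable ℝ η := hη.1.differentiable (by simp)
  have hi : ∀ {a : Euc N → ℝ}, IntegrableOn a Ω → ∀ v i,
      Integrable (fun x => a x * fderiv ℝ η (x, y x) v i) (volume.restrict Ω) := by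
    intro a ha v i
    obtain ⟨hc, C, hC⟩ := hη.continuous_and_bounded_fderiv v i
    exact ha.mul_bdd (c := C)
      (hc.measurable.comp_aemeasurable (aemeasurable_id.prodMk hy)).aestronglyMeasurable
      (ae_of_all _ fun x => hC _)
  have hcofi := fun i j => hi (hcof i j) (EuclideanSpace.single j 1, 0) i
  have hdeti := fun i => hi hdet (0, EuclideanSpace.single i 1) i
  simp only [SEta, frobInner, DxMatrix_apply hd, divXi_eq_sum hd,
    mul_comm _ (ContinuousLinearMap.det _), Finset.mul_sum]
  rw [integral_add (integrable_finsetSum _ fun i _ => integrable_finsetSum _ fun j _ => hcofi i j)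
    (integrable_finsetSum _ fun i _ => hdeti i),
    integral_finsetSum _ fun i _ => integrable_finsetSum _ fun j _ => hcofi i j,
    integral_finsetSum _ fun i _ => hdeti i]
  congr 1
  exact Finset.sum_congr rfl fun i _ => integral_finsetSum _ fun j _ => hcofi i j

/-- Lower semicontinuity of the surface energy under weak `L¹` convergence of the
cofactors and determinants (Remark on lower semicontinuity of `𝒮`). -/
theorem lsc_of_surface_energy {N : ℕ} (hN : 2 ≤ N)
    (Ω : Set (Euc N)) (hΩo : IsOpen Ω) (hΩb : Bornology.IsBounded Ω)
    (y : ℕ → Euc N → Euc N) (D : ℕ → Set (Euc N)) (f : ℕ → Euc N → Euc N →L[ℝ] Euc N)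
    (htri : ∀ n, ApproxDiffTriple Ω (D n) (y n) (f n))
    (hdetint : ∀ n, IntegrableOn (fun x => (f n x).det) Ω volume)
    (hcofint : ∀ n, ∀ i j, IntegrableOn (fun x => cofCLM (f n x) i j) Ω volume)
    (y₀ : Euc N → Euc N) (D₀ : Set (Euc N)) (f₀ : Euc N → Euc N →L[ℝ] Euc N)
    (htri₀ : ApproxDiffTriple Ω D₀ y₀ f₀)
    (hdetint₀ : IntegrableOn (fun x => (f₀ x).det) Ω volume)
    (hcofint₀ : ∀ i j, IntegrableOn (fun x => cofCLM (f₀ x) i j) Ω volume)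
    (hae : ∀ᵐ x ∂(volume.restrict Ω), Tendsto (fun n => y n x) atTop (𝓝 (y₀ x)))
    (hcof : ∀ i j, WeakL1ConvOn Ω (fun n x => cofCLM (f n x) i j) (fun x => cofCLM (f₀ x) i j))
    (hdet : WeakL1ConvOn Ω (fun n x => (f n x).det) (fun x => (f₀ x).det)) :
    surfaceEnergy Ω y₀ f₀ ≤ atTop.liminf (fun n => surfaceEnergy Ω (y n) (f n)) := by
  have hΩ : volume Ω ≠ ∞ := hΩb.measure_lt_top.ne
  refine iSup_le fun ⟨η, hη⟩ => ?_
  have hlim : Tendsto (fun n => SEta Ω (y n) (f n) η) atTop (𝓝 (SEta Ω y₀ f₀ η)) := by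
    simp only [fun n => SEta_eq_sum (htri n).aemeasurable (hdetint n) (hcofint n) hη,
      SEta_eq_sum htri₀.aemeasurable hdetint₀ hcofint₀ hη]
    refine (tendsto_finsetSum _ fun i _ => tendsto_finsetSum _ fun j _ => ?_).add
      (tendsto_finsetSum _ fun i _ => ?_)
    · obtain ⟨hc, C, hC⟩ := hη.continuous_and_bounded_fderiv (EuclideanSpace.single j 1, 0) i
      exact (hcof i j).tendsto_integral_mul_comp hΩ (fun n => hcofint n i j) (hcofint₀ i j)
        (fun n => (htri n).aemeasurable) htri₀.aemeasurable hae hc hC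
    · obtain ⟨hc, C, hC⟩ := hη.continuous_and_bounded_fderiv (0, EuclideanSpace.single i 1) i
      exact hdet.tendsto_integral_mul_comp hΩ hdetint hdetint₀
        (fun n => (htri n).aemeasurable) htri₀.aemeasurable hae hc hC
  rw [← ((ENNReal.continuous_ofReal.tendsto _).comp hlim).liminf_eq]
  exact liminf_le_liminf (Eventually.of_forall fun n =>
    le_iSup (fun ζ : { ζ : Euc N × Euc N → Euc N // TestFun Ω ζ } =>
      ENNReal.ofReal (SEta Ω (y n) (f n) ζ.1)) ⟨η, hη⟩)
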